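/- arXiv:1502.04533 — 6 statements merged into one kernel-verified Lean document; each statement's English description precedes it below -/
import Mathlib

section
/- Let 1 ≤ i < j < k ≤ n and consider the points v_i, ..., v_k only. Let (ρl, ρr) be a left-right assignment for these points that is valid, satisfies ρl(v_j) ≥ v_j − v_i and ρr(v_j) ≥ v_k − v_j, minimizes cost among all valid assignments satisfying these two constraints, and among those minimizes cost'. Then: for every m with i ≤ m < j, ρr(v_m) = v_{m+1} − v_m and ρl(v_m) = 0; and for every m with j < m ≤ k, ρl(v_m) = v_m − v_{m−1} and ρr(v_m) = 0. -/
/-- Directed edge of the communication graph induced by a left-right assignment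
`(ρl, ρr)` on the points with indices in `lo..hi`. -/
def LREdge (v ρl ρr : ℕ → ℝ) (lo hi : ℕ) (a b : ℕ) : Prop :=
  lo ≤ a ∧ a ≤ hi ∧ lo ≤ b ∧ b ≤ hi ∧
    ((a < b ∧ v b - v a ≤ ρr a) ∨ (b < a ∧ v a - v b ≤ ρl a))

/-- A left-right assignment is valid if its induced graph is strongly connected. -/
def LRValid (v ρl ρr : ℕ → ℝ) (lo hi : ℕ) : Prop :=
  ∀ a b : ℕ, lo ≤ a → a ≤ hi → lo ≤ b → b ≤ hi →
    Relation.ReflTransGen (LREdge v ρl ρr lo hi) a b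

/-- `cost(ρl,ρr) = Σ_i (max(ρl(v_i), ρr(v_i)))^α`. -/
noncomputable def LRCost (α : ℝ) (ρl ρr : ℕ → ℝ) (lo hi : ℕ) : ℝ :=
  ∑ i ∈ Finset.Icc lo hi, (max (ρl i) (ρr i)) ^ α

/-- `cost'(ρl,ρr) = Σ_i ((ρl(v_i))^α + (ρr(v_i))^α)`. -/
noncomputable def LRCost' (α : ℝ) (ρl ρr : ℕ → ℝ) (lo hi : ℕ) : ℝ :=
  ∑ i ∈ Finset.Icc lo hi, ((ρl i) ^ α + (ρr i) ^ α)

theorem Relation.ReflTransGen.exists_crossing {β : Type*} {R : β → β → Prop} {a b : β}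
    (h : Relation.ReflTransGen R a b) (P : β → Prop) (ha : P a) (hb : ¬ P b) :
    ∃ c d, R c d ∧ P c ∧ ¬ P d := by
  induction h with
  | refl => exact absurd ha hb
  | @tail c d _ hcd ih =>
    by_cases hc : P c
    · exact ⟨c, d, hcd, hc, hb⟩
    · exact ih hc

theorem sum_Ico_rpow_gap_le {α : ℝ} (hα : 1 ≤ α) (v : ℕ → ℝ) {a b : ℕ} (hab : a ≤ b)
    (hv : ∀ m, a ≤ m → m < b → v m ≤ v (m + 1)) :
    v a ≤ v b ∧ ∑ m ∈ Finset.Ico a b, (v (m + 1) - v m) ^ α ≤ (v b - v a) ^ α := by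
  induction b, hab using Nat.le_induction with
  | base => simp [Real.zero_rpow (by linarith : α ≠ 0)]
  | succ b hab ih =>
    obtain ⟨h1, h2⟩ := ih fun m hm hmb => hv m hm (by omega)
    have h3 := hv b hab (by omega)
    refine ⟨h1.trans h3, ?_⟩
    rw [Finset.sum_Ico_succ_top hab]
    have h4 := Real.add_rpow_le_rpow_add (sub_nonneg.2 h1) (sub_nonneg.2 h3) hα
    rw [show v b - v a + (v (b + 1) - v b) = v (b + 1) - v a by ring] at h4
    linarith

/-- If ranges to the right cover all gaps between consecutive points of `i..j`, then their power
sum is at least that of the gaps. -/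
theorem sum_gap_rpow_le_of_right_cover {α : ℝ} (hα : 1 ≤ α) (v r : ℕ → ℝ) (hr : ∀ m, 0 ≤ r m)
    (i j : ℕ) (hv : ∀ m, i ≤ m → m < j → v m ≤ v (m + 1))
    (hcov : ∀ m, i ≤ m → m < j → ∃ a, i ≤ a ∧ a ≤ m ∧ v (m + 1) - v a ≤ r a) :
    ∑ m ∈ Finset.Ico i j, (v (m + 1) - v m) ^ α ≤ ∑ m ∈ Finset.Ico i j, r m ^ α := by
  induction j using Nat.strong_induction_on with
  | _ j ih =>
    rcases Nat.lt_or_ge i j with hij | hij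
    · obtain ⟨a, hia, haj, ha⟩ := hcov (j - 1) (by omega) (by omega)
      rw [show j - 1 + 1 = j by omega] at ha
      have h1 := ih a (by omega) (fun m h h' => hv m h (by omega))
        (fun m h h' => hcov m h (by omega))
      obtain ⟨h2, h3⟩ := sum_Ico_rpow_gap_le hα v (a := a) (b := j) (by omega)
        (fun m h h' => hv m (by omega) h')
      have h4 : (v j - v a) ^ α ≤ r a ^ α :=
        Real.rpow_le_rpow (sub_nonneg.2 h2) ha (by linarith)
      have h5 : r a ^ α ≤ ∑ m ∈ Finset.Ico a j, r m ^ α :=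
        Finset.single_le_sum (f := fun m => r m ^ α) (fun m _ => Real.rpow_nonneg (hr m) α)
          (by simp; omega)
      rw [← Finset.sum_Ico_consecutive _ hia (by omega : a ≤ j),
        ← Finset.sum_Ico_consecutive _ hia (by omega : a ≤ j)]
      linarith
    · simp [Finset.Ico_eq_empty_of_le hij]

/-- If ranges to the left cover all gaps between consecutive points of `j..k`, then their power
sum is at least that of the gaps. -/
theorem sum_gap_rpow_le_of_left_cover {α : ℝ} (hα : 1 ≤ α) (v l : ℕ → ℝ) (hl : ∀ m, 0 ≤ l m)
    (j k : ℕ) (hv : ∀ m, j ≤ m → m < k → v m ≤ v (m + 1))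
    (hcov : ∀ m, j < m → m ≤ k → ∃ a, m ≤ a ∧ a ≤ k ∧ v a - v (m - 1) ≤ l a) :
    ∑ m ∈ Finset.Ico (j + 1) (k + 1), (v m - v (m - 1)) ^ α ≤
      ∑ m ∈ Finset.Ico (j + 1) (k + 1), l m ^ α := by
  induction h : k - j using Nat.strong_induction_on generalizing j with
  | _ d ih =>
    rcases Nat.lt_or_ge j k with hjk | hjk
    · obtain ⟨a, hja, hak, ha⟩ := hcov (j + 1) (by omega) (by omega)
      rw [Nat.add_sub_cancel] at ha
      have h1 := ih (k - a) (by omega) a (fun m h h' => hv m (by omega) h')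
        (fun m h h' => hcov m (by omega) h') rfl
      obtain ⟨h2, h3⟩ := sum_Ico_rpow_gap_le hα v (a := j) (b := a) (by omega)
        (fun m h h' => hv m h (by omega))
      have h4 : (v a - v j) ^ α ≤ l a ^ α :=
        Real.rpow_le_rpow (sub_nonneg.2 h2) ha (by linarith)
      have h5 : l a ^ α ≤ ∑ m ∈ Finset.Ico (j + 1) (a + 1), l m ^ α :=
        Finset.single_le_sum (f := fun m => l m ^ α) (fun m _ => Real.rpow_nonneg (hl m) α)
          (by simp; omega)
      have h6 := Finset.sum_Ico_add' (fun m => (v m - v (m - 1)) ^ α) j a 1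
      simp only [Nat.add_sub_cancel] at h6
      rw [← Finset.sum_Ico_consecutive _ (by omega : j + 1 ≤ a + 1) (by omega : a + 1 ≤ k + 1),
        ← Finset.sum_Ico_consecutive _ (by omega : j + 1 ≤ a + 1) (by omega : a + 1 ≤ k + 1)]
      linarith
    · simp [Finset.Ico_eq_empty_of_le (by omega : k + 1 ≤ j + 1)]

theorem sum_Icc_split (f : ℕ → ℝ) {i j k : ℕ} (hij : i ≤ j) (hjk : j ≤ k) :
    ∑ m ∈ Finset.Icc i k, f m =
      ∑ m ∈ Finset.Ico i j, f m + f j + ∑ m ∈ Finset.Ico (j + 1) (k + 1), f m := by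
  rw [show Finset.Icc i k = Finset.Ico i (k + 1) by ext; simp,
    ← Finset.sum_Ico_consecutive _ hij (by omega : j ≤ k + 1),
    Finset.sum_eq_sum_Ico_succ_bot (by omega : j < k + 1), add_assoc]

/-- In an optimal left-right assignment for the points `v_i, ..., v_k` subject to
`ρl(v_j) ≥ v_j − v_i` and `ρr(v_j) ≥ v_k − v_j` (where `i < j < k`), every point
strictly left of `v_j` has right range reaching exactly its right neighbour and left
range `0`, and symmetrically for the points right of `v_j`. -/
theorem stmt1 (n : ℕ) (hn : 2 ≤ n) (v : ℕ → ℝ)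
    (hv : ∀ m, 1 ≤ m → m < n → v m < v (m + 1))
    (α : ℝ) (hα : 1 ≤ α)
    (i j k : ℕ) (hi : 1 ≤ i) (hij : i < j) (hjk : j < k) (hk : k ≤ n)
    (ρl ρr : ℕ → ℝ)
    (hρl0 : ∀ m, 0 ≤ ρl m) (hρr0 : ∀ m, 0 ≤ ρr m)
    (hvalid : LRValid v ρl ρr i k)
    (hconl : v j - v i ≤ ρl j) (hconr : v k - v j ≤ ρr j)
    (hmin : ∀ σl σr : ℕ → ℝ, (∀ m, 0 ≤ σl m) → (∀ m, 0 ≤ σr m) →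
      LRValid v σl σr i k → v j - v i ≤ σl j → v k - v j ≤ σr j →
      LRCost α ρl ρr i k ≤ LRCost α σl σr i k)
    (hmin' : ∀ σl σr : ℕ → ℝ, (∀ m, 0 ≤ σl m) → (∀ m, 0 ≤ σr m) →
      LRValid v σl σr i k → v j - v i ≤ σl j → v k - v j ≤ σr j →
      LRCost α σl σr i k = LRCost α ρl ρr i k →
      LRCost' α ρl ρr i k ≤ LRCost' α σl σr i k) :
    (∀ m, i ≤ m → m < j → ρr m = v (m + 1) - v m ∧ ρl m = 0) ∧
    (∀ m, j < m → m ≤ k → ρl m = v m - v (m - 1) ∧ ρr m = 0) := by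
  have hα0 : α ≠ 0 := by linarith
  have hαpos : 0 < α := by linarith
  have hmono : ∀ a b, 1 ≤ a → a < b → b ≤ n → v a < v b := by
    intro a b ha hab
    induction b, hab using Nat.le_induction with
    | base => exact fun hb => hv a ha (by omega)
    | succ b hab ih => exact fun hb => (ih (by omega)).trans (hv b (by omega) (by omega))
  have hmono' : ∀ a b, 1 ≤ a → a ≤ b → b ≤ n → v a ≤ v b := by
    intro a b ha hab hb
    rcases hab.eq_or_lt with rfl | h
    · exact le_rfl
    · exact (hmono a b ha h hb).le
  have hL := sum_gap_rpow_le_of_right_cover hα v ρr hρr0 i j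
    (fun m h h' => hmono' _ _ (by omega) (by omega) (by omega)) (by
      intro m him hmj
      obtain ⟨c, d, ⟨h1, h2, h3, h4, h5⟩, hc, hd⟩ :=
        (hvalid i (m + 1) le_rfl (by omega) (by omega) (by omega)).exists_crossing
          (fun x => x ≤ m) him (by simp)
      refine ⟨c, h1, hc, ?_⟩
      rcases h5 with ⟨_, h⟩ | ⟨h, _⟩
      · have := hmono' (m + 1) d (by omega) (by omega) (by omega)
        linarith
      · omega)
  have hR := sum_gap_rpow_le_of_left_cover hα v ρl hρl0 j k
    (fun m h h' => hmono' _ _ (by omega) (by omega) (by omega)) (by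
      intro m hjm hmk
      obtain ⟨c, d, ⟨h1, h2, h3, h4, h5⟩, hc, hd⟩ :=
        (hvalid k (m - 1) (by omega) (by omega) (by omega) (by omega)).exists_crossing
          (fun x => m ≤ x) hmk (by omega)
      refine ⟨c, hc, h2, ?_⟩
      rcases h5 with ⟨h, _⟩ | ⟨_, h⟩
      · omega
      · have := hmono' d (m - 1) (by omega) (by omega) (by omega)
        linarith)
  set gL := ∑ m ∈ Finset.Ico i j, (v (m + 1) - v m) ^ α
  set gR := ∑ m ∈ Finset.Ico (j + 1) (k + 1), (v m - v (m - 1)) ^ α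
  have hA : 0 ≤ v j - v i := sub_nonneg.2 (hmono' i j hi hij.le (by omega))
  have hB : 0 ≤ v k - v j := sub_nonneg.2 (hmono' j k (by omega) hjk.le hk)
  obtain ⟨σl, hσl⟩ : ∃ σl : ℕ → ℝ, σl = fun m =>
    if m = j then v j - v i else if j < m ∧ m ≤ k then v m - v (m - 1) else 0 := ⟨_, rfl⟩
  obtain ⟨σr, hσr⟩ : ∃ σr : ℕ → ℝ, σr = fun m =>
    if m = j then v k - v j else if i ≤ m ∧ m < j then v (m + 1) - v m else 0 := ⟨_, rfl⟩
  have hlj : σl j = v j - v i := by simp [hσl]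
  have hrj : σr j = v k - v j := by simp [hσr]
  have hlL : ∀ m, m < j → σl m = 0 := by
    intro m hm
    rw [hσl]
    simp only [if_neg hm.ne, if_neg (by omega : ¬ (j < m ∧ m ≤ k))]
  have hrL : ∀ m, i ≤ m → m < j → σr m = v (m + 1) - v m := by
    intro m hm hmj
    rw [hσr]
    simp only [if_neg hmj.ne, if_pos (And.intro hm hmj)]
  have hlR : ∀ m, j < m → m ≤ k → σl m = v m - v (m - 1) := by
    intro m hm hmk
    rw [hσl]
    simp only [if_neg hm.ne', if_pos (And.intro hm hmk)]
  have hrR : ∀ m, j < m → σr m = 0 := by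
    intro m hm
    rw [hσr]
    simp only [if_neg hm.ne', if_neg (by omega : ¬ (i ≤ m ∧ m < j))]
  have hσl0 : ∀ m, 0 ≤ σl m := by
    intro m
    rw [hσl]
    dsimp only
    split_ifs with h1 h2
    · exact hA
    · exact sub_nonneg.2 (hmono' _ _ (by omega) (by omega) (by omega))
    · exact le_rfl
  have hσr0 : ∀ m, 0 ≤ σr m := by
    intro m
    rw [hσr]
    dsimp only
    split_ifs with h1 h2
    · exact hB
    · exact sub_nonneg.2 (hmono' _ _ (by omega) (by omega) (by omega))
    · exact le_rfl
  have hfrom : ∀ b, i ≤ b → b ≤ k → Relation.ReflTransGen (LREdge v σl σr i k) j b := by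
    intro b hib hbk
    rcases lt_trichotomy b j with h | rfl | h
    · have := hmono' i b hi hib (by omega)
      exact .single ⟨hij.le, hjk.le, hib, hbk, Or.inr ⟨h, by linarith⟩⟩
    · exact .refl
    · have := hmono' b k (by omega) hbk (by omega)
      exact .single ⟨hij.le, hjk.le, hib, hbk, Or.inl ⟨h, by linarith⟩⟩
  have hto : ∀ a, i ≤ a → a ≤ k → Relation.ReflTransGen (LREdge v σl σr i k) a j := by
    intro a hia hak
    rcases Nat.le_total a j with h | h
    · induction h using Nat.decreasingInduction with
      | self => exact .refl
      | of_succ a h ih =>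
        exact .head ⟨hia, hak, by omega, by omega, Or.inl ⟨by omega, (hrL a hia h).ge⟩⟩
          (ih (by omega) (by omega))
    · induction a, h using Nat.le_induction with
      | base => exact .refl
      | succ a h ih =>
        exact .head ⟨hia, hak, by omega, by omega,
          Or.inr ⟨by omega, (hlR (a + 1) (by omega) hak).ge⟩⟩ (ih (by omega) (by omega))
  have hσv : LRValid v σl σr i k := fun a b h1 h2 h3 h4 => (hto a h1 h2).trans (hfrom b h3 h4)
  have hcσ : LRCost α σl σr i k = gL + max (v j - v i) (v k - v j) ^ α + gR := by
    rw [LRCost, sum_Icc_split _ hij.le hjk.le, hlj, hrj]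
    congr 1
    · congr 1
      refine Finset.sum_congr rfl fun m hm => ?_
      rw [Finset.mem_Ico] at hm
      have := hσr0 m
      rw [hlL m hm.2, max_eq_right this, hrL m hm.1 hm.2]
    · refine Finset.sum_congr rfl fun m hm => ?_
      rw [Finset.mem_Ico] at hm
      have := hσl0 m
      rw [hrR m (by omega), max_eq_left this, hlR m (by omega) (by omega)]
  have hcσ' : LRCost' α σl σr i k = gL + ((v j - v i) ^ α + (v k - v j) ^ α) + gR := by
    rw [LRCost', sum_Icc_split _ hij.le hjk.le, hlj, hrj]
    congr 1
    · congr 1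
      refine Finset.sum_congr rfl fun m hm => ?_
      rw [Finset.mem_Ico] at hm
      rw [hlL m hm.2, hrL m hm.1 hm.2, Real.zero_rpow hα0, zero_add]
    · refine Finset.sum_congr rfl fun m hm => ?_
      rw [Finset.mem_Ico] at hm
      rw [hrR m (by omega), hlR m (by omega) (by omega), Real.zero_rpow hα0, add_zero]
  have hcρ : gL + max (v j - v i) (v k - v j) ^ α + gR ≤ LRCost α ρl ρr i k := by
    rw [LRCost, sum_Icc_split _ hij.le hjk.le]
    refine add_le_add (add_le_add (hL.trans (Finset.sum_le_sum fun m _ => ?_)) ?_)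
      (hR.trans (Finset.sum_le_sum fun m _ => ?_))
    · exact Real.rpow_le_rpow (hρr0 m) (le_max_right _ _) hαpos.le
    · exact Real.rpow_le_rpow (le_max_of_le_left hA) (max_le_max hconl hconr) hαpos.le
    · exact Real.rpow_le_rpow (hρl0 m) (le_max_left _ _) hαpos.le
  have hle := hmin' σl σr hσl0 hσr0 hσv hlj.ge hrj.ge
    (le_antisymm (hcσ.trans_le hcρ) (hmin σl σr hσl0 hσr0 hσv hlj.ge hrj.ge))
  rw [hcσ', LRCost', sum_Icc_split _ hij.le hjk.le, Finset.sum_add_distrib,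
    Finset.sum_add_distrib] at hle
  have hjl := Real.rpow_le_rpow hA hconl hαpos.le
  have hjr := Real.rpow_le_rpow hB hconr hαpos.le
  have hnl : ∀ m, 0 ≤ ρl m ^ α := fun m => Real.rpow_nonneg (hρl0 m) α
  have hnr : ∀ m, 0 ≤ ρr m ^ α := fun m => Real.rpow_nonneg (hρr0 m) α
  have hsl : 0 ≤ ∑ m ∈ Finset.Ico i j, ρl m ^ α := Finset.sum_nonneg fun m _ => hnl m
  have hsr : 0 ≤ ∑ m ∈ Finset.Ico (j + 1) (k + 1), ρr m ^ α :=
    Finset.sum_nonneg fun m _ => hnr m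
  have hl0 : ∀ m, i ≤ m → m < j → ρl m = 0 := by
    intro m h h'
    have := (Finset.sum_eq_zero_iff_of_nonneg fun m _ => hnl m).1
      (le_antisymm (by linarith) hsl) m (Finset.mem_Ico.2 ⟨h, h'⟩)
    exact (Real.rpow_eq_zero (hρl0 m) hα0).1 this
  have hr0 : ∀ m, j < m → m ≤ k → ρr m = 0 := by
    intro m h h'
    have := (Finset.sum_eq_zero_iff_of_nonneg fun m _ => hnr m).1
      (le_antisymm (by linarith) hsr) m (Finset.mem_Ico.2 ⟨h, by omega⟩)
    exact (Real.rpow_eq_zero (hρr0 m) hα0).1 this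
  have hgapL : ∀ m, i ≤ m → m < j → v (m + 1) - v m ≤ ρr m := by
    intro m h h'
    obtain ⟨c, d, ⟨h1, h2, h3, h4, h5⟩, rfl, hd⟩ :=
      (hvalid m j h (by omega) (by omega) (by omega)).exists_crossing (fun x => x = m) rfl h'.ne'
    rcases h5 with ⟨h6, h7⟩ | ⟨h6, h7⟩
    · have := hmono' (c + 1) d (by omega) (by omega) (by omega)
      linarith
    · have := hmono d c (by omega) h6 (by omega)
      have := hl0 c h h'
      linarith
  have hgapR : ∀ m, j < m → m ≤ k → v m - v (m - 1) ≤ ρl m := by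
    intro m h h'
    obtain ⟨c, d, ⟨h1, h2, h3, h4, h5⟩, rfl, hd⟩ :=
      (hvalid m j (by omega) h' (by omega) (by omega)).exists_crossing (fun x => x = m) rfl h.ne
    rcases h5 with ⟨h6, h7⟩ | ⟨h6, h7⟩
    · have := hmono c d (by omega) h6 (by omega)
      have := hr0 c h h'
      linarith
    · have := hmono' d (c - 1) (by omega) (by omega) (by omega)
      linarith
  have hgL0 : ∀ m, i ≤ m → m < j → 0 ≤ v (m + 1) - v m := fun m h h' =>
    sub_nonneg.2 (hmono' _ _ (by omega) (by omega) (by omega))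
  have hgR0 : ∀ m, j < m → m ≤ k → 0 ≤ v m - v (m - 1) := fun m h h' =>
    sub_nonneg.2 (hmono' _ _ (by omega) (by omega) (by omega))
  refine ⟨fun m h h' => ⟨?_, hl0 m h h'⟩, fun m h h' => ⟨?_, hr0 m h h'⟩⟩
  · have := (Finset.sum_eq_sum_iff_of_le (s := Finset.Ico i j)
      (f := fun m => (v (m + 1) - v m) ^ α) (g := fun m => ρr m ^ α) (fun m hm => by
        rw [Finset.mem_Ico] at hm
        exact Real.rpow_le_rpow (hgL0 m hm.1 hm.2) (hgapL m hm.1 hm.2) hαpos.le)).1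
      (le_antisymm hL (by linarith)) m (Finset.mem_Ico.2 ⟨h, h'⟩)
    exact ((Real.rpow_left_inj (hgL0 m h h') (hρr0 m) hα0).1 this).symm
  · have := (Finset.sum_eq_sum_iff_of_le (s := Finset.Ico (j + 1) (k + 1))
      (f := fun m => (v m - v (m - 1)) ^ α) (g := fun m => ρl m ^ α) (fun m hm => by
        rw [Finset.mem_Ico] at hm
        exact Real.rpow_le_rpow (hgR0 m hm.1 (by omega)) (hgapR m hm.1 (by omega)) hαpos.le)).1
      (le_antisymm hR (by linarith)) m (Finset.mem_Ico.2 ⟨h, by omega⟩)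
    exact ((Real.rpow_left_inj (hgR0 m h h') (hρl0 m) hα0).1 this).symm
end

section
/- In an optimal left-right assignment (ρl, ρr) for points v_1 < v_2 < ... < v_n on a line, the leftmost point satisfies ρl(v_1) = 0 and ρr(v_1) = v_2 − v_1. -/
theorem lt_of_lt_of_forall_lt_succ {n : ℕ} {v : ℕ → ℝ}
    (hv : ∀ m, 1 ≤ m → m < n → v m < v (m + 1)) {i j : ℕ} (hi : 1 ≤ i) (hij : i < j)
    (hj : j ≤ n) : v i < v j := by
  induction j, hij using Nat.le_induction with
  | base => exact hv i hi hj
  | succ k hk ih => exact (ih (by lia)).trans (hv k (by lia) hj)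

theorem LRValid.exists_edge {v ρl ρr : ℕ → ℝ} {lo hi : ℕ} (h : LRValid v ρl ρr lo hi) {a b : ℕ}
    (ha : lo ≤ a) (ha' : a ≤ hi) (hb : lo ≤ b) (hb' : b ≤ hi) (hab : a ≠ b) :
    ∃ c, LREdge v ρl ρr lo hi a c := by
  rcases (h a b ha ha' hb hb').cases_head with rfl | ⟨c, hc, -⟩
  · exact absurd rfl hab
  · exact ⟨c, hc⟩

theorem LRValid.of_edge {v ρl ρr σl σr : ℕ → ℝ} {lo hi : ℕ} (h : LRValid v ρl ρr lo hi)
    (hedge : ∀ a b, LREdge v ρl ρr lo hi a b →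
      Relation.ReflTransGen (LREdge v σl σr lo hi) a b) :
    LRValid v σl σr lo hi := by
  intro a b ha ha' hb hb'
  have hab := h a b ha ha' hb hb'
  induction hab with
  | refl => exact .refl
  | tail _ hbc ih => exact (ih hbc.1 hbc.2.1).trans (hedge _ _ hbc)

/-- The left range of the leftmost point is irrelevant to the induced graph. -/
theorem LRValid.update_left_zero {v ρl ρr : ℕ → ℝ} {lo hi : ℕ} (h : LRValid v ρl ρr lo hi) :
    LRValid v (Function.update ρl lo 0) ρr lo hi := by
  refine h.of_edge fun a b ⟨ha, ha', hb, hb', hab⟩ ↦ .single ⟨ha, ha', hb, hb', ?_⟩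
  refine hab.imp_right fun ⟨hba, hle⟩ ↦ ⟨hba, ?_⟩
  rwa [Function.update_of_ne (by lia)]

/-- The right range of point `1` may be cut down to the distance to point `2` if point `2` takes
over the remainder. -/
theorem LRValid.update_right {v ρl ρr : ℕ → ℝ} {n : ℕ} (hn : 2 ≤ n) (h : LRValid v ρl ρr 1 n) :
    LRValid v ρl (Function.update (Function.update ρr 1 (v 2 - v 1)) 2
      (max (ρr 2) (ρr 1 - (v 2 - v 1)))) 1 n := by
  refine h.of_edge fun a b ⟨ha, ha', hb, hb', hab⟩ ↦ ?_
  rcases hab with ⟨hab, hle⟩ | hab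
  · obtain rfl | rfl | h2 : a = 1 ∨ a = 2 ∨ 2 < a := by lia
    · have h12 : LREdge v ρl (Function.update (Function.update ρr 1 (v 2 - v 1)) 2
          (max (ρr 2) (ρr 1 - (v 2 - v 1)))) 1 n 1 2 :=
        ⟨le_rfl, ha', one_le_two, hn, .inl ⟨one_lt_two, by simp⟩⟩
      obtain rfl | h2 : b = 2 ∨ 2 < b := by lia
      · exact .single h12
      · refine .tail (.single h12) ⟨one_le_two, hn, hb, hb', .inl ⟨h2, ?_⟩⟩
        rw [Function.update_self]
        exact le_max_of_le_right (by linarith)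
    · refine .single ⟨ha, ha', hb, hb', .inl ⟨hab, ?_⟩⟩
      rw [Function.update_self]
      exact le_max_of_le_left hle
    · refine .single ⟨ha, ha', hb, hb', .inl ⟨hab, ?_⟩⟩
      rwa [Function.update_of_ne (by lia), Function.update_of_ne (by lia)]
  · exact .single ⟨ha, ha', hb, hb', .inr hab⟩

theorem Real.rpow_add_max_rpow_lt {α d r m : ℝ} (hα : 1 ≤ α) (hd : 0 ≤ d) (hr : d < r)
    (hm : 0 < m) : d ^ α + max m (r - d) ^ α < r ^ α + m ^ α := by
  have hsum : d ^ α + (r - d) ^ α ≤ r ^ α := by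
    simpa using Real.add_rpow_le_rpow_add hd (sub_nonneg.2 hr.le) hα
  have hmpos : 0 < m ^ α := Real.rpow_pos_of_pos hm α
  have hrdpos : 0 < (r - d) ^ α := Real.rpow_pos_of_pos (sub_pos.2 hr) α
  rcases max_choice m (r - d) with h | h <;> rw [h] <;> linarith

theorem Finset.sum_Icc_one_eq_add_add {n : ℕ} (hn : 2 ≤ n) (f : ℕ → ℝ) :
    ∑ i ∈ Finset.Icc 1 n, f i = f 1 + (f 2 + ∑ i ∈ Finset.Icc 3 n, f i) := by
  rw [← Finset.add_sum_Ioc_eq_sum_Icc (by lia : 1 ≤ n), ← Finset.Icc_succ_left_eq_Ioc,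
    ← Finset.add_sum_Ioc_eq_sum_Icc (by exact hn), ← Finset.Icc_succ_left_eq_Ioc]
  rfl

/-- In an optimal left-right assignment the leftmost point has left range `0` and
right range exactly the distance to its right neighbour. -/
theorem stmt2 (n : ℕ) (hn : 2 ≤ n) (v : ℕ → ℝ)
    (hv : ∀ m, 1 ≤ m → m < n → v m < v (m + 1))
    (α : ℝ) (hα : 1 ≤ α)
    (ρl ρr : ℕ → ℝ)
    (hρl0 : ∀ m, 0 ≤ ρl m) (hρr0 : ∀ m, 0 ≤ ρr m)
    (hvalid : LRValid v ρl ρr 1 n)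
    (hmin : ∀ σl σr : ℕ → ℝ, (∀ m, 0 ≤ σl m) → (∀ m, 0 ≤ σr m) →
      LRValid v σl σr 1 n → LRCost α ρl ρr 1 n ≤ LRCost α σl σr 1 n)
    (hmin' : ∀ σl σr : ℕ → ℝ, (∀ m, 0 ≤ σl m) → (∀ m, 0 ≤ σr m) →
      LRValid v σl σr 1 n → LRCost α σl σr 1 n = LRCost α ρl ρr 1 n →
      LRCost' α ρl ρr 1 n ≤ LRCost' α σl σr 1 n) :
    ρl 1 = 0 ∧ ρr 1 = v 2 - v 1 := by
  have hα0 : 0 < α := by linarith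
  have h12 : v 1 < v 2 := hv 1 le_rfl hn
  have hl : ρl 1 = 0 := by
    by_contra hne
    have hpos : 0 < ρl 1 := (hρl0 1).lt_of_ne' hne
    have hσ0 : ∀ m, 0 ≤ Function.update ρl 1 0 m := fun m ↦ by
      rw [Function.update_apply]
      split_ifs
      exacts [le_rfl, hρl0 m]
    have hσle : ∀ m, Function.update ρl 1 0 m ≤ ρl m := fun m ↦ by
      rw [Function.update_apply]
      split_ifs
      exacts [hρl0 m, le_rfl]
    have hcost : LRCost α (Function.update ρl 1 0) ρr 1 n ≤ LRCost α ρl ρr 1 n :=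
      Finset.sum_le_sum fun i _ ↦ Real.rpow_le_rpow (le_max_of_le_left (hσ0 i))
        (max_le_max_right _ (hσle i)) hα0.le
    have hcost' : LRCost' α (Function.update ρl 1 0) ρr 1 n < LRCost' α ρl ρr 1 n := by
      refine Finset.sum_lt_sum (fun i _ ↦ ?_) ⟨1, Finset.mem_Icc.2 ⟨le_rfl, by lia⟩, ?_⟩
      · gcongr
        exacts [hσ0 i, hσle i]
      · rw [Function.update_self, Real.zero_rpow hα0.ne']
        linarith [Real.rpow_pos_of_pos hpos α]
    have hvalid' := hvalid.update_left_zero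
    exact (hmin' _ _ hσ0 hρr0 hvalid'
      (hcost.antisymm (hmin _ _ hσ0 hρr0 hvalid'))).not_gt hcost'
  refine ⟨hl, le_antisymm ?_ ?_⟩
  · by_contra! hlt
    have hm : 0 < max (ρl 2) (ρr 2) := by
      obtain ⟨c, -, -, hc, hc', ⟨h2c, hle⟩ | ⟨hc2, hle⟩⟩ :=
        hvalid.exists_edge one_le_two hn le_rfl (by lia : 1 ≤ n) (by lia)
      · exact lt_max_of_lt_right
          ((sub_pos.2 (lt_of_lt_of_forall_lt_succ hv one_le_two h2c hc')).trans_le hle)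
      · exact lt_max_of_lt_left
          ((sub_pos.2 (lt_of_lt_of_forall_lt_succ hv hc hc2 hn)).trans_le hle)
    refine (hmin _ _ hρl0 (fun m ↦ ?_) (hvalid.update_right hn)).not_gt ?_
    · rw [Function.update_apply, Function.update_apply]
      split_ifs
      exacts [le_max_of_le_left (hρr0 2), (sub_pos.2 h12).le, hρr0 m]
    · have hrest : ∀ i ∈ Finset.Icc 3 n,
          max (ρl i) (Function.update (Function.update ρr 1 (v 2 - v 1)) 2
            (max (ρr 2) (ρr 1 - (v 2 - v 1))) i) ^ α = max (ρl i) (ρr i) ^ α := fun i hi ↦ by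
        have := (Finset.mem_Icc.1 hi).1
        rw [Function.update_of_ne (by lia), Function.update_of_ne (by lia)]
      rw [LRCost, LRCost, Finset.sum_Icc_one_eq_add_add hn, Finset.sum_Icc_one_eq_add_add hn,
        Finset.sum_congr rfl hrest, Function.update_self, Function.update_of_ne (by lia),
        Function.update_self, hl, max_eq_right (sub_pos.2 h12).le, max_eq_right (hρr0 1),
        ← max_assoc]
      linarith [Real.rpow_add_max_rpow_lt hα (sub_pos.2 h12).le hlt hm]
  · obtain ⟨c, -, -, hc, hc', ⟨h1c, hle⟩ | ⟨hc1, -⟩⟩ :=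
      hvalid.exists_edge le_rfl (by lia) one_le_two hn (by lia)
    · obtain rfl | h2c : c = 2 ∨ 2 < c := by lia
      · exact hle
      · linarith [lt_of_lt_of_forall_lt_succ hv one_le_two h2c hc']
    · lia
end

section
/- For every index i with 1 ≤ i ≤ n−2, OPT(i) = min over all pairs (k, k') with i < k < n and k < k' ≤ n of [ Σ_{m=i}^{k'−2} (v_{m+1} − v_m)^α + OPT(k'−1) − (v_{k'} − v_{k'−1})^α + max( (v_k − v_i)^α, (v_{k'} − v_k)^α ) ]. -/
/-- `OPT(i)`: the infimum of `cost` over all valid left-right assignments for the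
points `v_i, ..., v_n` subject to the constraint `ρr(v_i) = v_{i+1} − v_i`. -/
noncomputable def OPT (n : ℕ) (v : ℕ → ℝ) (α : ℝ) (i : ℕ) : ℝ :=
  sInf { c : ℝ | ∃ ρl ρr : ℕ → ℝ, (∀ m, 0 ≤ ρl m) ∧ (∀ m, 0 ≤ ρr m) ∧
    LRValid v ρl ρr i n ∧ ρr i = v (i + 1) - v i ∧ c = LRCost α ρl ρr i n }

/-- The induced graph is strongly connected iff every proper interval of consecutive indices has a
member reaching a neighbour of the interval. -/
theorem lrValid_iff {v ρl ρr : ℕ → ℝ} {lo hi : ℕ}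
    (hv : MonotoneOn v (Set.Icc lo hi)) :
    LRValid v ρl ρr lo hi ↔ ∀ a b, lo ≤ a → a ≤ b → b ≤ hi → (lo < a ∨ b < hi) →
      ∃ u, a ≤ u ∧ u ≤ b ∧
        ((lo < a ∧ v u - v (a - 1) ≤ ρl u) ∨ (b < hi ∧ v (b + 1) - v u ≤ ρr u)) := by
  constructor
  · intro h a b ha hab hb hne
    by_contra! hcl
    have key : ∀ y, Relation.ReflTransGen (LREdge v ρl ρr lo hi) a y → a ≤ y ∧ y ≤ b := by
      intro y hy
      induction hy with
      | refl => exact ⟨le_rfl, hab⟩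
      | @tail u w _ huw ih =>
        obtain ⟨h1, h2, h3, h4, h5⟩ := huw
        obtain ⟨hl, hr⟩ := hcl u ih.1 ih.2
        by_contra hw
        rcases h5 with ⟨h5, h6⟩ | ⟨h5, h6⟩
        · have := hr (by omega)
          have := hv (a := b + 1) (b := w) ⟨by omega, by omega⟩ ⟨h3, h4⟩ (by omega)
          linarith
        · have := hl (by omega)
          have := hv (a := w) (b := a - 1) ⟨h3, h4⟩ ⟨by omega, by omega⟩ (by omega)
          linarith
    rcases hne with hne | hne
    · have := key lo (h a lo ha (by omega) le_rfl (by omega)); omega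
    · have := key hi (h a hi ha (by omega) (by omega) le_rfl); omega
  · intro h x y hx hx' hy hy'
    have key : ∀ d a b, hi - lo - (b - a) = d → lo ≤ a → a ≤ b → b ≤ hi →
        (∀ z, a ≤ z → z ≤ b → Relation.ReflTransGen (LREdge v ρl ρr lo hi) x z) →
        Relation.ReflTransGen (LREdge v ρl ρr lo hi) x y := by
      intro d
      induction d with
      | zero => intro a b hd ha hab hb hz; exact hz y (by omega) (by omega)
      | succ d ih =>
        intro a b hd ha hab hb hz
        obtain ⟨u, hu1, hu2, hu⟩ := h a b ha hab hb (by omega)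
        rcases hu with ⟨hl, hu⟩ | ⟨hr, hu⟩
        · refine ih (a - 1) b (by omega) (by omega) (by omega) hb fun z hz1 hz2 => ?_
          by_cases hza : a ≤ z
          · exact hz z hza hz2
          · obtain rfl : z = a - 1 := by omega
            exact (hz u hu1 hu2).tail ⟨by omega, by omega, by omega, by omega,
              Or.inr ⟨by omega, hu⟩⟩
        · refine ih a (b + 1) (by omega) (by omega) (by omega) hr fun z hz1 hz2 => ?_
          by_cases hza : z ≤ b
          · exact hz z hz1 hza
          · obtain rfl : z = b + 1 := by omega
            exact (hz u hu1 hu2).tail ⟨by omega, by omega, by omega, by omega,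
              Or.inl ⟨by omega, hu⟩⟩
    refine key _ x x rfl hx le_rfl hx' fun z h1 h2 => ?_
    obtain rfl : z = x := by omega
    exact .refl

theorem Finset.sum_rpow_le_rpow_sum {ι : Type*} (s : Finset ι) {f : ι → ℝ} {α : ℝ} (hα : 1 ≤ α)
    (hf : ∀ j ∈ s, 0 ≤ f j) : ∑ j ∈ s, f j ^ α ≤ (∑ j ∈ s, f j) ^ α := by
  classical
  induction s using Finset.induction_on with
  | empty => simp [Real.zero_rpow (by linarith : α ≠ 0)]
  | insert a s ha ih =>
    rw [Finset.sum_insert ha, Finset.sum_insert ha]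
    have hs : ∀ j ∈ s, 0 ≤ f j := fun j hj => hf j (Finset.mem_insert_of_mem hj)
    calc _ ≤ f a ^ α + (∑ j ∈ s, f j) ^ α := by gcongr; exact ih hs
      _ ≤ _ := Real.add_rpow_le_rpow_add (hf a (Finset.mem_insert_self _ _))
        (Finset.sum_nonneg hs) hα

theorem sum_gap_rpow_le_of_subset_Ico {w : ℕ → ℝ} {α : ℝ} (hα : 1 ≤ α) {c d : ℕ} (hcd : c ≤ d)
    (hw : MonotoneOn w (Set.Icc c d)) {s : Finset ℕ} (hs : s ⊆ Finset.Ico c d) :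
    ∑ g ∈ s, (w (g + 1) - w g) ^ α ≤ (w d - w c) ^ α := by
  have h0 : ∀ g ∈ Finset.Ico c d, 0 ≤ w (g + 1) - w g := by
    intro g hg
    rw [Finset.mem_Ico] at hg
    exact sub_nonneg.2 (hw ⟨by omega, by omega⟩ ⟨by omega, by omega⟩ (by omega))
  rw [← Finset.sum_Ico_sub w hcd]
  calc _ ≤ ∑ g ∈ Finset.Ico c d, (w (g + 1) - w g) ^ α :=
        Finset.sum_le_sum_of_subset_of_nonneg hs fun g hg _ => Real.rpow_nonneg (h0 g hg) _
    _ ≤ _ := Finset.sum_rpow_le_rpow_sum _ hα h0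

/-- If every gap between consecutive points is bridged to the right by a point of `P`, then the
points of `P` pay for all the gaps. -/
theorem sum_gap_rpow_le_of_right_cover_s3 {w ρ : ℕ → ℝ} {α : ℝ} (hα : 1 ≤ α) {a b : ℕ}
    (hw : MonotoneOn w (Set.Icc a b)) (P : Finset ℕ) (hρ : ∀ p, 0 ≤ ρ p)
    (hP : ∀ g, a ≤ g → g < b → ∃ p ∈ P, a ≤ p ∧ p ≤ g ∧ w (g + 1) - w p ≤ ρ p) :
    ∑ g ∈ Finset.Ico a b, (w (g + 1) - w g) ^ α ≤ ∑ p ∈ P, ρ p ^ α := by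
  choose! f hfP hfa hfg hf using hP
  rw [← Finset.sum_fiberwise_of_maps_to (s := Finset.Ico a b) (t := P) (g := f)
    (fun g hg => hfP g (Finset.mem_Ico.1 hg).1 (Finset.mem_Ico.1 hg).2)]
  refine Finset.sum_le_sum fun p hp => ?_
  set F := (Finset.Ico a b).filter (fun g => f g = p) with hF
  have hmem : ∀ g ∈ F, (a ≤ g ∧ g < b) ∧ f g = p := fun g hg => by simpa [hF] using hg
  rcases F.eq_empty_or_nonempty with h | h
  · rw [h, Finset.sum_empty]
    exact Real.rpow_nonneg (hρ p) _
  · obtain ⟨⟨h1, h2⟩, h3⟩ := hmem _ (F.max'_mem h)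
    set M := F.max' h
    have h4 := hfa M h1 h2
    have h5 := hfg M h1 h2
    have h6 := hf M h1 h2
    rw [h3] at h4 h5 h6
    have hmono : MonotoneOn w (Set.Icc p (M + 1)) := hw.mono (Set.Icc_subset_Icc h4 (by omega))
    refine (sum_gap_rpow_le_of_subset_Ico hα (c := p) (d := M + 1) (by omega) hmono
      fun g hg => ?_).trans (Real.rpow_le_rpow ?_ h6 (by linarith))
    · obtain ⟨⟨h7, h8⟩, h9⟩ := hmem g hg
      have := hfg g h7 h8
      have := F.le_max' g hg
      rw [Finset.mem_Ico]
      omega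
    · exact sub_nonneg.2 (hmono ⟨le_rfl, by omega⟩ ⟨by omega, le_rfl⟩ (by omega))

/-- The mirror image of `sum_gap_rpow_le_of_right_cover`. -/
theorem sum_gap_rpow_le_of_left_cover_s3 {w ρ : ℕ → ℝ} {α : ℝ} (hα : 1 ≤ α) {a b : ℕ}
    (hw : MonotoneOn w (Set.Icc a b)) (P : Finset ℕ) (hρ : ∀ p, 0 ≤ ρ p)
    (hP : ∀ g, a ≤ g → g < b → ∃ p ∈ P, g < p ∧ p ≤ b ∧ w p - w g ≤ ρ p) :
    ∑ g ∈ Finset.Ico a b, (w (g + 1) - w g) ^ α ≤ ∑ p ∈ P, ρ p ^ α := by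
  choose! f hfP hfg hfb hf using hP
  rw [← Finset.sum_fiberwise_of_maps_to (s := Finset.Ico a b) (t := P) (g := f)
    (fun g hg => hfP g (Finset.mem_Ico.1 hg).1 (Finset.mem_Ico.1 hg).2)]
  refine Finset.sum_le_sum fun p hp => ?_
  set F := (Finset.Ico a b).filter (fun g => f g = p) with hF
  have hmem : ∀ g ∈ F, (a ≤ g ∧ g < b) ∧ f g = p := fun g hg => by simpa [hF] using hg
  rcases F.eq_empty_or_nonempty with h | h
  · rw [h, Finset.sum_empty]
    exact Real.rpow_nonneg (hρ p) _
  · obtain ⟨⟨h1, h2⟩, h3⟩ := hmem _ (F.min'_mem h)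
    set M := F.min' h
    have h4 := hfb M h1 h2
    have h5 := hfg M h1 h2
    have h6 := hf M h1 h2
    rw [h3] at h4 h5 h6
    have hmono : MonotoneOn w (Set.Icc M p) := hw.mono (Set.Icc_subset_Icc h1 h4)
    refine (sum_gap_rpow_le_of_subset_Ico hα (c := M) (d := p) (by omega) hmono
      fun g hg => ?_).trans (Real.rpow_le_rpow ?_ h6 (by linarith))
    · obtain ⟨⟨h7, h8⟩, h9⟩ := hmem g hg
      have := hfg g h7 h8
      have := F.min'_le g hg
      rw [Finset.mem_Ico]
      omega
    · exact sub_nonneg.2 (hmono ⟨le_rfl, by omega⟩ ⟨by omega, le_rfl⟩ (by omega))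

theorem OPT_le {n : ℕ} {v : ℕ → ℝ} {α : ℝ} {i : ℕ} {ρl ρr : ℕ → ℝ} (hl : ∀ m, 0 ≤ ρl m)
    (hr : ∀ m, 0 ≤ ρr m) (hval : LRValid v ρl ρr i n) (hi : ρr i = v (i + 1) - v i) :
    OPT n v α i ≤ LRCost α ρl ρr i n := by
  refine csInf_le ⟨0, ?_⟩ ⟨ρl, ρr, hl, hr, hval, hi, rfl⟩
  rintro _ ⟨ρl, ρr, hl, -, -, -, rfl⟩
  exact Finset.sum_nonneg fun m _ => Real.rpow_nonneg (le_max_of_le_left (hl m)) _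

theorem le_OPT {n : ℕ} {v : ℕ → ℝ} {α : ℝ} {i : ℕ} {B : ℝ} (hv : MonotoneOn v (Set.Icc i n))
    (hi : i < n)
    (hB : ∀ ρl ρr : ℕ → ℝ, (∀ m, 0 ≤ ρl m) → (∀ m, 0 ≤ ρr m) → LRValid v ρl ρr i n →
      ρr i = v (i + 1) - v i → B ≤ LRCost α ρl ρr i n) :
    B ≤ OPT n v α i := by
  have hg : 0 ≤ v (i + 1) - v i :=
    sub_nonneg.2 (hv ⟨le_rfl, by omega⟩ ⟨by omega, by omega⟩ (by omega))
  have hD : 0 ≤ v n - v i := sub_nonneg.2 (hv ⟨le_rfl, by omega⟩ ⟨by omega, le_rfl⟩ (by omega))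
  refine le_csInf ⟨_, fun _ => v n - v i, fun m => if m = i then v (i + 1) - v i else v n - v i,
    fun _ => hD, fun m => ?_, ?_, if_pos rfl, rfl⟩ ?_
  · dsimp only; split_ifs <;> assumption
  · rw [lrValid_iff hv]
    intro a b ha hab hb hne
    refine ⟨b, hab, le_rfl, ?_⟩
    have hbn := hv (a := b) (b := n) ⟨by omega, by omega⟩ ⟨by omega, by omega⟩ hb
    have hib := hv (a := i) (b := b) ⟨by omega, by omega⟩ ⟨by omega, by omega⟩ (by omega)
    by_cases h : i < a
    · left
      have := hv (a := i) (b := a - 1) ⟨by omega, by omega⟩ ⟨by omega, by omega⟩ (by omega)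
      exact ⟨h, by linarith⟩
    · right
      refine ⟨by omega, ?_⟩
      split_ifs with hbi
      · rw [hbi]
      · have := hv (a := b + 1) (b := n) ⟨by omega, by omega⟩ ⟨by omega, by omega⟩ (by omega)
        linarith
  · rintro _ ⟨ρl, ρr, hl, hr, hval, hi, rfl⟩
    exact hB ρl ρr hl hr hval hi

theorem LRCost_eq_add {α : ℝ} {ρl ρr : ℕ → ℝ} {lo mid hi : ℕ} (h1 : lo ≤ mid) (h2 : mid ≤ hi) :
    LRCost α ρl ρr lo hi =
      ∑ m ∈ Finset.Ico lo mid, (max (ρl m) (ρr m)) ^ α + LRCost α ρl ρr mid hi := by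
  have hIcc : ∀ a, Finset.Icc a hi = Finset.Ico a (hi + 1) := fun a => by
    ext; simp only [Finset.mem_Icc, Finset.mem_Ico]; omega
  simp only [LRCost, hIcc]
  rw [Finset.sum_Ico_consecutive _ h1 (by omega)]

theorem LRCost_succ {α : ℝ} {ρl ρr : ℕ → ℝ} {lo hi : ℕ} (h : lo < hi) :
    LRCost α ρl ρr lo hi = (max (ρl lo) (ρr lo)) ^ α + LRCost α ρl ρr (lo + 1) hi := by
  rw [LRCost_eq_add (Nat.le_succ lo) h]
  simp

theorem LRCost_congr {α : ℝ} {ρl ρr ρl' ρr' : ℕ → ℝ} {lo hi : ℕ}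
    (hl : ∀ m, lo ≤ m → ρl m = ρl' m) (hr : ∀ m, lo ≤ m → ρr m = ρr' m) :
    LRCost α ρl ρr lo hi = LRCost α ρl' ρr' lo hi :=
  Finset.sum_congr rfl fun m hm => by
    rw [hl m (Finset.mem_Icc.1 hm).1, hr m (Finset.mem_Icc.1 hm).1]

theorem OPT_pred_le {n : ℕ} {v : ℕ → ℝ} {α : ℝ} {j : ℕ} (hv : MonotoneOn v (Set.Icc j (j + 1)))
    (hn : n = j + 1) : OPT n v α j ≤ 2 * (v (j + 1) - v j) ^ α := by
  subst hn
  have hg : 0 ≤ v (j + 1) - v j :=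
    sub_nonneg.2 (hv ⟨le_rfl, by omega⟩ ⟨by omega, by omega⟩ (by omega))
  refine (OPT_le (ρl := fun _ => v (j + 1) - v j) (ρr := fun _ => v (j + 1) - v j)
    (fun _ => hg) (fun _ => hg) ?_ rfl).trans ?_
  · rw [lrValid_iff hv]
    intro a b ha hab hb hne
    refine ⟨a, le_rfl, hab, ?_⟩
    by_cases h : j < a
    · obtain rfl : a = j + 1 := by omega
      exact Or.inl ⟨h, le_rfl⟩
    · obtain rfl : a = j := by omega
      obtain rfl : b = a := by omega
      exact Or.inr ⟨by omega, le_rfl⟩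
  · rw [LRCost_succ (by omega)]
    simp [LRCost, two_mul]

/-- The value of the recurrence for the hub `k` and `k' = s + 1`. -/
noncomputable def hubValue (n : ℕ) (v : ℕ → ℝ) (α : ℝ) (i k s : ℕ) : ℝ :=
  (∑ m ∈ Finset.Ico i s, (v (m + 1) - v m) ^ α) + OPT n v α s - (v (s + 1) - v s) ^ α
    + max ((v k - v i) ^ α) ((v (s + 1) - v k) ^ α)

theorem OPT_le_hubValue {n : ℕ} {v : ℕ → ℝ} {α : ℝ} (hα : 0 ≤ α) {i k s : ℕ}
    (hv : StrictMonoOn v (Set.Icc i n)) (hik : i < k) (hks : k ≤ s) (hsn : s < n) :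
    OPT n v α i ≤ hubValue n v α i k s := by
  have hle : ∀ a b, i ≤ a → a ≤ b → b ≤ n → v a ≤ v b := fun a b h1 h2 h3 =>
    hv.monotoneOn ⟨h1, by omega⟩ ⟨by omega, h3⟩ h2
  have hvs : MonotoneOn v (Set.Icc s n) :=
    hv.monotoneOn.mono (Set.Icc_subset_Icc_left (by omega))
  suffices OPT n v α i - (∑ m ∈ Finset.Ico i s, (v (m + 1) - v m) ^ α)
      + (v (s + 1) - v s) ^ α - max ((v k - v i) ^ α) ((v (s + 1) - v k) ^ α) ≤ OPT n v α s by
    unfold hubValue; linarith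
  refine le_OPT hvs hsn fun ρl ρr hl hr hval hs => ?_
  rw [lrValid_iff hvs] at hval
  set L : ℕ → ℝ := fun m => if m < k then 0 else if m = k then v k - v i else
    if m ≤ s then v m - v (m - 1) else ρl m with hL
  set R : ℕ → ℝ := fun m => if m < i then 0 else if m < k then v (m + 1) - v m else
    if m = k then v (s + 1) - v k else if m ≤ s then 0 else ρr m with hR
  have L_lt : ∀ m, m < k → L m = 0 := fun m h => if_pos h
  have L_k : L k = v k - v i := by simp [hL]
  have L_mid : ∀ m, k < m → m ≤ s → L m = v m - v (m - 1) := fun m h h' => by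
    simp only [hL]
    rw [if_neg (by omega), if_neg (by omega), if_pos h']
  have L_gt : ∀ m, s < m → L m = ρl m := fun m h => by
    simp only [hL]
    rw [if_neg (by omega), if_neg (by omega), if_neg (by omega)]
  have R_lt : ∀ m, i ≤ m → m < k → R m = v (m + 1) - v m := fun m h h' => by
    simp only [hR]
    rw [if_neg (by omega), if_pos h']
  have R_k : R k = v (s + 1) - v k := by
    simp only [hR]
    rw [if_neg (by omega), if_neg (by omega), if_pos trivial]
  have R_mid : ∀ m, k < m → m ≤ s → R m = 0 := fun m h h' => by
    simp only [hR]
    rw [if_neg (by omega), if_neg (by omega), if_neg (by omega), if_pos h']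
  have R_gt : ∀ m, s < m → R m = ρr m := fun m h => by
    simp only [hR]
    rw [if_neg (by omega), if_neg (by omega), if_neg (by omega), if_neg (by omega)]
  have hki := hle i k le_rfl hik.le (by omega)
  have hsk := hle k (s + 1) hik.le (by omega) (by omega)
  have hL0 : ∀ m, 0 ≤ L m := fun m => by
    rcases lt_trichotomy m k with h | rfl | h
    · rw [L_lt m h]
    · rw [L_k]; linarith
    · rcases le_or_gt m s with h' | h'
      · rw [L_mid m h h']
        linarith [hle (m - 1) m (by omega) (by omega) (by omega)]
      · rw [L_gt m h']; exact hl m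
  have hR0 : ∀ m, 0 ≤ R m := fun m => by
    rcases lt_or_ge m i with hi | hi
    · simp [hR, hi]
    rcases lt_trichotomy m k with h | rfl | h
    · rw [R_lt m hi h]
      linarith [hle m (m + 1) (by omega) (by omega) (by omega)]
    · rw [R_k]; linarith
    · rcases le_or_gt m s with h' | h'
      · rw [R_mid m h h']
      · rw [R_gt m h']; exact hr m
  have hvalid : LRValid v L R i n := by
    rw [lrValid_iff hv.monotoneOn]
    intro a b ha hab hb hne
    by_cases hbk : b < k
    · exact ⟨b, hab, le_rfl, Or.inr ⟨by omega, (R_lt b (by omega) hbk).ge⟩⟩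
    by_cases hak : a ≤ k
    · by_cases hai : i < a
      · refine ⟨k, hak, by omega, Or.inl ⟨hai, ?_⟩⟩
        rw [L_k]
        linarith [hle i (a - 1) le_rfl (by omega) (by omega)]
      by_cases hbs : b ≤ s
      · refine ⟨k, hak, by omega, Or.inr ⟨by omega, ?_⟩⟩
        rw [R_k]
        linarith [hle (b + 1) (s + 1) (by omega) (by omega) (by omega)]
      obtain ⟨u, hu1, hu2, hu⟩ := hval s b le_rfl (by omega) hb (by omega)
      rcases hu with ⟨hu, -⟩ | ⟨hu, hu'⟩
      · omega
      rcases hu1.eq_or_lt with rfl | hu3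
      · have := hv (a := s + 1) (b := b + 1) ⟨by omega, by omega⟩ ⟨by omega, by omega⟩ (by omega)
        linarith
      · exact ⟨u, by omega, hu2, Or.inr ⟨hu, by rwa [R_gt u hu3]⟩⟩
    by_cases has : a ≤ s
    · exact ⟨a, le_rfl, hab, Or.inl ⟨by omega, (L_mid a (by omega) has).ge⟩⟩
    obtain ⟨u, hu1, hu2, hu⟩ := hval a b (by omega) hab hb (by omega)
    refine ⟨u, hu1, hu2, ?_⟩
    rw [L_gt u (by omega), R_gt u (by omega)]
    exact hu.imp (fun h => ⟨by omega, h.2⟩) id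
  have hopt := OPT_le (α := α) hL0 hR0 hvalid (R_lt i le_rfl hik)
  rw [LRCost_eq_add (mid := k) (by omega) (by omega), LRCost_succ (by omega),
    LRCost_eq_add (mid := s + 1) (by omega) (by omega),
    LRCost_congr (lo := s + 1) (fun m hm => L_gt m hm) (fun m hm => R_gt m hm)] at hopt
  have e1 : ∑ m ∈ Finset.Ico i k, (max (L m) (R m)) ^ α
      = ∑ m ∈ Finset.Ico i k, (v (m + 1) - v m) ^ α :=
    Finset.sum_congr rfl fun m hm => by
      rw [Finset.mem_Ico] at hm
      rw [L_lt m hm.2, ← R_lt m hm.1 hm.2, max_eq_right (hR0 m)]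
  have e2 : ∑ m ∈ Finset.Ico (k + 1) (s + 1), (max (L m) (R m)) ^ α
      = ∑ m ∈ Finset.Ico k s, (v (m + 1) - v m) ^ α := by
    rw [← Finset.sum_Ico_add']
    refine Finset.sum_congr rfl fun m hm => ?_
    rw [Finset.mem_Ico] at hm
    rw [R_mid _ (by omega) (by omega), max_eq_left (hL0 _), L_mid _ (by omega) (by omega),
      Nat.add_sub_cancel]
  have e3 : (max (L k) (R k)) ^ α ≤ max ((v k - v i) ^ α) ((v (s + 1) - v k) ^ α) := by
    rw [L_k, R_k]
    rcases max_choice (v k - v i) (v (s + 1) - v k) with h | h <;> rw [h]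
    · exact le_max_left _ _
    · exact le_max_right _ _
  have e4 : (v (s + 1) - v s) ^ α ≤ (max (ρl s) (ρr s)) ^ α :=
    Real.rpow_le_rpow (by linarith [hle s (s + 1) (by omega) (by omega) (by omega)])
      (hs ▸ le_max_right _ _) hα
  have e5 := Finset.sum_Ico_consecutive (fun m => (v (m + 1) - v m) ^ α) hik.le hks
  rw [LRCost_succ hsn]
  linarith

theorem exists_hubValue_le_LRCost {n : ℕ} {v : ℕ → ℝ} {α : ℝ} (hα : 1 ≤ α) {i : ℕ}
    (hv : MonotoneOn v (Set.Icc i n)) (hin : i + 1 < n) {ρl ρr : ℕ → ℝ}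
    (hl : ∀ m, 0 ≤ ρl m) (hr : ∀ m, 0 ≤ ρr m) (hval : LRValid v ρl ρr i n) :
    ∃ k s, i < k ∧ k ≤ s ∧ s < n ∧ hubValue n v α i k s ≤ LRCost α ρl ρr i n := by
  have hle : ∀ a b, i ≤ a → a ≤ b → b ≤ n → v a ≤ v b := fun a b h1 h2 h3 =>
    hv ⟨h1, by omega⟩ ⟨by omega, h3⟩ h2
  have hα0 : 0 ≤ α := by linarith
  rw [lrValid_iff hv] at hval
  set ρ : ℕ → ℝ := fun m => max (ρl m) (ρr m) with hρ
  have hρ0 : ∀ m, 0 ≤ ρ m := fun m => le_max_of_le_left (hl m)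
  have hlρ : ∀ m, ρl m ≤ ρ m := fun m => le_max_left _ _
  have hrρ : ∀ m, ρr m ≤ ρ m := fun m => le_max_right _ _
  have hright : ∀ g, i ≤ g → g < n → ∃ p, i ≤ p ∧ p ≤ g ∧ v (g + 1) - v p ≤ ρ p := by
    intro g hg hgn
    obtain ⟨p, hp1, hp2, hp⟩ := hval i g le_rfl hg (by omega) (by omega)
    rcases hp with ⟨hp, -⟩ | ⟨-, hp⟩
    · omega
    · exact ⟨p, hp1, hp2, hp.trans (hrρ p)⟩
  obtain ⟨k, hik, hkn, hk⟩ : ∃ k, i < k ∧ k ≤ n ∧ v k - v i ≤ ρ k := by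
    obtain ⟨k, hk1, hk2, hk⟩ := hval (i + 1) n (by omega) (by omega) le_rfl (by omega)
    rcases hk with ⟨-, hk⟩ | ⟨hk, -⟩
    · exact ⟨k, hk1, hk2, hk.trans (hlρ k)⟩
    · omega
  have hkcost : (v k - v i) ^ α ≤ ρ k ^ α :=
    Real.rpow_le_rpow (by linarith [hle i k le_rfl hik.le hkn]) hk hα0
  have hchain : ∑ g ∈ Finset.Ico i k, (v (g + 1) - v g) ^ α ≤ ∑ p ∈ Finset.Ico i k, ρ p ^ α := by
    refine sum_gap_rpow_le_of_right_cover_s3 hα (hv.mono (Set.Icc_subset_Icc_right hkn)) _ hρ0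
      fun g hg hgk => ?_
    obtain ⟨p, hp1, hp2, hp⟩ := hright g hg (by omega)
    exact ⟨p, Finset.mem_Ico.2 ⟨hp1, by omega⟩, hp1, hp2, hp⟩
  rcases hkn.eq_or_lt with rfl | hkn
  · -- Only the last point is known to reach `i`: its predecessor serves as the hub.
    obtain ⟨s, rfl⟩ : ∃ s, k = s + 1 := ⟨k - 1, by omega⟩
    refine ⟨s, s, by omega, le_rfl, by omega, ?_⟩
    rw [LRCost_eq_add (mid := s + 1) (by omega) le_rfl]
    have e1 : LRCost α ρl ρr (s + 1) (s + 1) = ρ (s + 1) ^ α := by simp [LRCost, hρ]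
    have e2 := OPT_pred_le (α := α) (j := s)
      (hv.mono (Set.Icc_subset_Icc_left (by omega))) rfl
    have e3 : max ((v s - v i) ^ α) ((v (s + 1) - v s) ^ α) ≤ (v (s + 1) - v i) ^ α := by
      have h1 := hle i s le_rfl (by omega) (by omega)
      have h2 := hle s (s + 1) (by omega) (by omega) (by omega)
      exact max_le (Real.rpow_le_rpow (by linarith) (by linarith) hα0)
        (Real.rpow_le_rpow (by linarith) (by linarith) hα0)
    rw [Finset.sum_Ico_succ_top (by omega)] at hchain
    unfold hubValue
    linarith
  classical
  -- The least `t > k` such that the points from `t` on bridge all later gaps to the right.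
  have hex : ∃ t, k < t ∧ t ≤ n ∧ ∀ b, t ≤ b → b < n →
      ∃ p, t ≤ p ∧ p ≤ b ∧ v (b + 1) - v p ≤ ρr p :=
    ⟨n, hkn, le_rfl, fun b h1 h2 => by omega⟩
  obtain ⟨hkt, htn, ht⟩ := Nat.find_spec hex
  have hmin : ∀ t' < Nat.find hex, _ := fun t' => Nat.find_min hex (m := t')
  obtain ⟨s, hs⟩ : ∃ s, Nat.find hex = s + 1 := ⟨Nat.find hex - 1, by omega⟩
  rw [hs] at hkt htn ht hmin
  have hno : ∀ p, k < p → p ≤ s → ¬ (v (s + 1) - v p ≤ ρr p) := by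
    intro p hkp hps hp
    refine hmin p (by omega) ⟨hkp, by omega, fun b hpb hbn => ?_⟩
    rcases le_or_gt b s with hbs | hbs
    · exact ⟨p, le_rfl, hpb, by linarith [hle (b + 1) (s + 1) (by omega) (by omega) (by omega)]⟩
    · obtain ⟨q, hq1, hq2, hq⟩ := ht b hbs hbn
      exact ⟨q, by omega, hq2, hq⟩
  obtain ⟨u, hiu, huk, hu⟩ : ∃ u, i ≤ u ∧ u ≤ k ∧ v (s + 1) - v u ≤ ρ u := by
    obtain ⟨u, hu1, hu2, hu⟩ := hval i s le_rfl (by omega) (by omega) (by omega)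
    rcases hu with ⟨hu, -⟩ | ⟨-, hu⟩
    · omega
    · refine ⟨u, hu1, ?_, hu.trans (hrρ u)⟩
      by_contra h
      exact hno u (by omega) hu2 hu
  have hback : ∑ g ∈ Finset.Ico k s, (v (g + 1) - v g) ^ α
      ≤ ∑ p ∈ Finset.Ico (k + 1) (s + 1), ρ p ^ α := by
    refine sum_gap_rpow_le_of_left_cover_s3 hα
      (hv.mono (Set.Icc_subset_Icc (by omega) (by omega))) _ hρ0 fun g hg hgs => ?_
    obtain ⟨q, hq1, hq2, hq⟩ := hval (g + 1) s (by omega) (by omega) (by omega) (by omega)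
    rcases hq with ⟨-, hq⟩ | ⟨-, hq⟩
    · exact ⟨q, Finset.mem_Ico.2 ⟨by omega, by omega⟩, by omega, hq2, hq.trans (hlρ q)⟩
    · exact absurd hq (hno q (by omega) hq2)
  have hsk := hle k (s + 1) (by omega) (by omega) (by omega)
  have hfront : ∑ g ∈ Finset.Ico i k, (v (g + 1) - v g) ^ α
      + max ((v k - v i) ^ α) ((v (s + 1) - v k) ^ α)
      ≤ ∑ p ∈ Finset.Ico i k, ρ p ^ α + ρ k ^ α := by
    rcases huk.eq_or_lt with rfl | huk
    · exact add_le_add hchain (max_le hkcost (Real.rpow_le_rpow (by linarith) hu hα0))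
    · set w : ℕ → ℝ := fun m => if m ≤ k then v m else v (s + 1) with hw
      have w_le : ∀ m, m ≤ k → w m = v m := fun m h => if_pos h
      have w_gt : w (k + 1) = v (s + 1) := if_neg (by omega)
      have hwm : MonotoneOn w (Set.Icc i (k + 1)) := by
        intro a ha b hb hab
        simp only [Set.mem_Icc] at ha hb
        simp only [hw]
        split_ifs
        · exact hle a b ha.1 hab (by omega)
        · exact hle a (s + 1) ha.1 (by omega) htn
        · omega
        · exact le_rfl
      have h := sum_gap_rpow_le_of_right_cover_s3 hα hwm (Finset.Ico i k) hρ0 fun g hg hgk => by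
        rcases (Nat.lt_succ_iff.1 hgk).eq_or_lt with rfl | hgk
        · exact ⟨u, Finset.mem_Ico.2 ⟨hiu, huk⟩, hiu, huk.le, by rwa [w_gt, w_le u huk.le]⟩
        · obtain ⟨p, hp1, hp2, hp⟩ := hright g hg (by omega)
          exact ⟨p, Finset.mem_Ico.2 ⟨hp1, by omega⟩, hp1, hp2,
            by rwa [w_le _ hgk, w_le p (by omega)]⟩
      rw [Finset.sum_Ico_succ_top hik.le, w_gt, w_le k le_rfl] at h
      have e : ∑ g ∈ Finset.Ico i k, (w (g + 1) - w g) ^ α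
          = ∑ g ∈ Finset.Ico i k, (v (g + 1) - v g) ^ α :=
        Finset.sum_congr rfl fun g hg => by
          rw [Finset.mem_Ico] at hg
          rw [w_le _ hg.2, w_le g hg.2.le]
      have h1 : 0 ≤ (v k - v i) ^ α :=
        Real.rpow_nonneg (by linarith [hle i k le_rfl hik.le hkn.le]) _
      have h2 : 0 ≤ (v (s + 1) - v k) ^ α := Real.rpow_nonneg (by linarith) _
      have h3 := max_le_add_of_nonneg h1 h2
      linarith
  have hgap : 0 ≤ v (s + 1) - v s := by linarith [hle s (s + 1) (by omega) (by omega) (by omega)]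
  have htail : OPT n v α s ≤ (v (s + 1) - v s) ^ α + LRCost α ρl ρr (s + 1) n := by
    set L : ℕ → ℝ := fun m => if m = s then 0 else ρl m with hL
    set R : ℕ → ℝ := fun m => if m = s then v (s + 1) - v s else ρr m with hR
    have L_ne : ∀ m, m ≠ s → L m = ρl m := fun m h => if_neg h
    have R_ne : ∀ m, m ≠ s → R m = ρr m := fun m h => if_neg h
    have L_s : L s = 0 := if_pos rfl
    have R_s : R s = v (s + 1) - v s := if_pos rfl
    have hopt := OPT_le (n := n) (v := v) (α := α) (i := s) (ρl := L) (ρr := R)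
      (fun m => by simp only [hL]; split_ifs; exacts [le_rfl, hl m])
      (fun m => by simp only [hR]; split_ifs; exacts [hgap, hr m]) ?_ R_s
    · rwa [LRCost_succ htn, L_s, R_s, max_eq_right hgap,
        LRCost_congr (fun m hm => L_ne m (by omega)) (fun m hm => R_ne m (by omega))] at hopt
    · rw [lrValid_iff (hv.mono (Set.Icc_subset_Icc_left (by omega)))]
      intro a b ha hab hb hne
      rcases ha.eq_or_lt with rfl | ha
      · rcases hab.eq_or_lt with rfl | hab
        · exact ⟨s, le_rfl, le_rfl, Or.inr ⟨htn, R_s.ge⟩⟩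
        · obtain ⟨p, hp1, hp2, hp⟩ := ht b hab (by omega)
          exact ⟨p, by omega, hp2, Or.inr ⟨by omega, by rwa [R_ne p (by omega)]⟩⟩
      · obtain ⟨p, hp1, hp2, hp⟩ := hval a b (by omega) hab hb (by omega)
        refine ⟨p, hp1, hp2, ?_⟩
        rw [L_ne p (by omega), R_ne p (by omega)]
        exact hp.imp (fun h => ⟨ha, h.2⟩) id
  refine ⟨k, s, hik, by omega, htn, ?_⟩
  rw [LRCost_eq_add (mid := k) (by omega) (by omega), LRCost_succ (by omega),
    LRCost_eq_add (lo := k + 1) (mid := s + 1) (by omega) (by omega)]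
  have e := Finset.sum_Ico_consecutive (fun m => (v (m + 1) - v m) ^ α) hik.le
    (Nat.lt_succ_iff.1 hkt)
  unfold hubValue
  linarith

/-- The recurrence of the dynamic program: `OPT(i)` equals the minimum over all
pairs `(k, k')` with `i < k < n` and `k < k' ≤ n` of
`Σ_{m=i}^{k'−2} (v_{m+1}−v_m)^α + OPT(k'−1) − (v_{k'}−v_{k'−1})^α
  + max((v_k−v_i)^α, (v_{k'}−v_k)^α)`. -/
theorem stmt3 (n : ℕ) (hn : 2 ≤ n) (v : ℕ → ℝ)
    (hv : ∀ m, 1 ≤ m → m < n → v m < v (m + 1))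
    (α : ℝ) (hα : 1 ≤ α)
    (i : ℕ) (hi1 : 1 ≤ i) (hi2 : i ≤ n - 2) :
    OPT n v α i =
      sInf { x : ℝ | ∃ k k' : ℕ, i < k ∧ k < n ∧ k < k' ∧ k' ≤ n ∧
        x = (∑ m ∈ Finset.Icc i (k' - 2), (v (m + 1) - v m) ^ α)
            + OPT n v α (k' - 1) - (v k' - v (k' - 1)) ^ α
            + max ((v k - v i) ^ α) ((v k' - v k) ^ α) } := by
  have hmono : StrictMonoOn v (Set.Icc 1 n) :=
    strictMonoOn_of_lt_add_one Set.ordConnected_Icc fun m _ h1 h2 => hv m h1.1 h2.2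
  have hv' : StrictMonoOn v (Set.Icc i n) := hmono.mono (Set.Icc_subset_Icc_left hi1)
  have hset : { x : ℝ | ∃ k k' : ℕ, i < k ∧ k < n ∧ k < k' ∧ k' ≤ n ∧
        x = (∑ m ∈ Finset.Icc i (k' - 2), (v (m + 1) - v m) ^ α)
            + OPT n v α (k' - 1) - (v k' - v (k' - 1)) ^ α
            + max ((v k - v i) ^ α) ((v k' - v k) ^ α) } =
      { x : ℝ | ∃ k s : ℕ, i < k ∧ k ≤ s ∧ s < n ∧ x = hubValue n v α i k s } := by
    have hIcc : ∀ s, i < s → Finset.Icc i (s + 1 - 2) = Finset.Ico i s := fun s hs => by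
      ext; simp only [Finset.mem_Icc, Finset.mem_Ico]; omega
    ext x
    constructor
    · rintro ⟨k, k', h1, h2, h3, h4, rfl⟩
      obtain ⟨s, rfl⟩ : ∃ s, k' = s + 1 := ⟨k' - 1, by omega⟩
      refine ⟨k, s, h1, by omega, by omega, ?_⟩
      rw [hIcc s (by omega), Nat.add_sub_cancel, hubValue]
    · rintro ⟨k, s, h1, h2, h3, rfl⟩
      refine ⟨k, s + 1, h1, by omega, by omega, by omega, ?_⟩
      rw [hIcc s (by omega), Nat.add_sub_cancel, hubValue]
  rw [hset]
  have hlower : ∀ x ∈ { x : ℝ | ∃ k s : ℕ, i < k ∧ k ≤ s ∧ s < n ∧ x = hubValue n v α i k s },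
      OPT n v α i ≤ x := by
    rintro _ ⟨k, s, h1, h2, h3, rfl⟩
    exact OPT_le_hubValue (by linarith) hv' h1 h2 h3
  refine le_antisymm
    (le_csInf ⟨_, i + 1, i + 1, by omega, le_rfl, by omega, rfl⟩ hlower)
    (le_OPT hv'.monotoneOn (by omega) fun ρl ρr hl hr hval _ => ?_)
  obtain ⟨k, s, h1, h2, h3, h⟩ :=
    exists_hubValue_le_LRCost hα hv'.monotoneOn (by omega) hl hr hval
  exact (csInf_le ⟨_, hlower⟩ ⟨k, s, h1, h2, h3, rfl⟩).trans h
end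

section
/- Let v_1 < v_2 < ... < v_n be points on a line, let G be any directed graph on these points, and let t ≥ 1 be real. Then G is a t-spanner if and only if for every i with 1 ≤ i < n there exist a directed path in G from v_i to v_{i+1} of length at most t·(v_{i+1} − v_i) and a directed path in G from v_{i+1} to v_i of length at most t·(v_{i+1} − v_i). -/
/-- `Reach v G a b r`: there is a directed path from index `a` to index `b` in the
graph `G` whose length (sum of Euclidean distances `|v_x − v_y|` over its edges)
is exactly `r`. -/
inductive Reach (v : ℕ → ℝ) (G : ℕ → ℕ → Prop) : ℕ → ℕ → ℝ → Prop
  | refl (a : ℕ) : Reach v G a a 0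
  | step {a b c : ℕ} {r : ℝ} : G a b → Reach v G b c r → Reach v G a c (|v a - v b| + r)

/-- `G` is a `t`-spanner for the points `v_1, ..., v_n`: between every two distinct
points there is a directed path of length at most `t` times their distance. -/
def IsSpanner (n : ℕ) (v : ℕ → ℝ) (G : ℕ → ℕ → Prop) (t : ℝ) : Prop :=
  ∀ a b : ℕ, 1 ≤ a → a ≤ n → 1 ≤ b → b ≤ n → a ≠ b →
    ∃ r : ℝ, Reach v G a b r ∧ r ≤ t * |v a - v b|

theorem Reach.trans {v : ℕ → ℝ} {G : ℕ → ℕ → Prop} {a b c : ℕ} {r s : ℝ}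
    (hab : Reach v G a b r) (hbc : Reach v G b c s) : Reach v G a c (r + s) := by
  induction hab with
  | refl a => simpa using hbc
  | step h _ ih => simpa only [add_assoc] using Reach.step h (ih hbc)

/-- Short paths in both directions between consecutive points concatenate to short paths
in both directions between any two points; the points are also increasing. -/
theorem exists_reach_of_consecutive {n : ℕ} {v : ℕ → ℝ} {G : ℕ → ℕ → Prop} {t : ℝ}
    (hv : ∀ m, 1 ≤ m → m < n → v m < v (m + 1))
    (h : ∀ i, 1 ≤ i → i < n →
      (∃ r : ℝ, Reach v G i (i + 1) r ∧ r ≤ t * (v (i + 1) - v i)) ∧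
      (∃ r : ℝ, Reach v G (i + 1) i r ∧ r ≤ t * (v (i + 1) - v i)))
    {a b : ℕ} (ha : 1 ≤ a) (hab : a ≤ b) (hb : b ≤ n) :
    v a ≤ v b ∧ (∃ r : ℝ, Reach v G a b r ∧ r ≤ t * (v b - v a)) ∧
      (∃ r : ℝ, Reach v G b a r ∧ r ≤ t * (v b - v a)) := by
  induction b, hab using Nat.le_induction with
  | base => exact ⟨le_rfl, ⟨0, .refl a, by simp⟩, ⟨0, .refl a, by simp⟩⟩
  | succ b hab ih =>
    obtain ⟨hle, ⟨r, hr, hrt⟩, ⟨s, hs, hst⟩⟩ := ih (by lia)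
    obtain ⟨⟨r', hr', hrt'⟩, ⟨s', hs', hst'⟩⟩ := h b (by lia) (by lia)
    exact ⟨hle.trans (hv b (by lia) (by lia)).le,
      ⟨r + r', hr.trans hr', by linarith⟩, ⟨s' + s, hs'.trans hs, by linarith⟩⟩

/-- A directed graph on points `v_1 < ... < v_n` on a line is a `t`-spanner iff
every pair of consecutive points is connected, in both directions, by a path of
length at most `t` times their distance. -/
theorem stmt7 (n : ℕ) (hn : 2 ≤ n) (v : ℕ → ℝ)
    (hv : ∀ m, 1 ≤ m → m < n → v m < v (m + 1))
    (G : ℕ → ℕ → Prop)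
    (hG : ∀ a b, G a b → 1 ≤ a ∧ a ≤ n ∧ 1 ≤ b ∧ b ≤ n)
    (t : ℝ) (ht : 1 ≤ t) :
    IsSpanner n v G t ↔
      ∀ i, 1 ≤ i → i < n →
        (∃ r : ℝ, Reach v G i (i + 1) r ∧ r ≤ t * (v (i + 1) - v i)) ∧
        (∃ r : ℝ, Reach v G (i + 1) i r ∧ r ≤ t * (v (i + 1) - v i)) := by
  constructor
  · intro h i hi hin
    have hpos := sub_pos.mpr (hv i hi hin)
    have hup := h i (i + 1) hi hin.le (by lia) hin (by lia)
    have hdown := h (i + 1) i (by lia) hin hi hin.le (by lia)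
    rw [abs_sub_comm, abs_of_pos hpos] at hup
    rw [abs_of_pos hpos] at hdown
    exact ⟨hup, hdown⟩
  · intro h a b ha han hb hbn _
    rcases le_total a b with hab | hba
    · obtain ⟨hle, hup, _⟩ := exists_reach_of_consecutive hv h ha hab hbn
      rwa [abs_sub_comm, abs_of_nonneg (sub_nonneg.mpr hle)]
    · obtain ⟨hle, _, hdown⟩ := exists_reach_of_consecutive hv h hb hba han
      rwa [abs_of_nonneg (sub_nonneg.mpr hle)]
end

section
/- Let ε = 5/10^5, c_s = 5/4, c_h = 20ε and c_k = 19. Then there do not exist real numbers r, t, l, x, each lying in [0, 1], such that all four of the following quantities are strictly greater than 1.5 − ε: A1 = (1.5 − (r − l)/2)/(1 + l); A2 = (1.5 − ((t − c_h)·(1 − 1/c_s) − l − r)/2)/(1 + l); A3 = 1 + (1 − x + (r + t))/2 + 2l; and A4 = c_s + (c_k + 2c_s·(c_k + 1) + 1)·(r + t) + 2x. -/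
/-- With `ε = 5/10^5`, `c_s = 5/4`, `c_h = 20ε` and `c_k = 19`, the four upper
bounds on the approximation ratios of Solutions (i)–(iv) cannot all be strictly
greater than `1.5 − ε`; hence the algorithm is a `(1.5 − ε)`-approximation. -/
theorem stmt10 (ε cs ch ck : ℝ)
    (hε : ε = 5 / 10 ^ 5) (hcs : cs = 5 / 4) (hch : ch = 20 * ε) (hck : ck = 19) :
    ¬ ∃ r t l x : ℝ,
      r ∈ Set.Icc (0 : ℝ) 1 ∧ t ∈ Set.Icc (0 : ℝ) 1 ∧
      l ∈ Set.Icc (0 : ℝ) 1 ∧ x ∈ Set.Icc (0 : ℝ) 1 ∧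
      1.5 - ε < (1.5 - (r - l) / 2) / (1 + l) ∧
      1.5 - ε < (1.5 - ((t - ch) * (1 - 1 / cs) - l - r) / 2) / (1 + l) ∧
      1.5 - ε < 1 + (1 - x + (r + t)) / 2 + 2 * l ∧
      1.5 - ε < cs + (ck + 2 * cs * (ck + 1) + 1) * (r + t) + 2 * x := by
  subst hch hε hcs hck
  rintro ⟨r, t, l, x, -, -, ⟨hl, -⟩, -, h1, h2, h3, h4⟩
  have hl' : 0 < 1 + l := by linarith
  rw [lt_div_iff₀ hl'] at h1 h2
  norm_num at h1 h2 h3 h4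
  linarith
end

section
/- Let p_1, p_2, ..., p_z (z ≥ 1) be points in d-dimensional Euclidean space and let m be an index with 1 ≤ m ≤ z. Define a range assignment ρ by: ρ(p_i) = ‖p_i − p_{i+1}‖ for i < m, ρ(p_i) = ‖p_i − p_{i−1}‖ for i > m, and ρ(p_m) = max(‖p_m − p_1‖, ‖p_m − p_z‖). Then the induced directed graph, which has an edge from p_i to p_j (i ≠ j) iff ‖p_i − p_j‖ ≤ ρ(p_i), is strongly connected. -/
/-- Validity of the path part of Solution (ii): directing the path
`p_1, ..., p_z` towards a hub point `p_m` assigned the radius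
`max(‖p_m − p_1‖, ‖p_m − p_z‖)` yields a strongly connected communication graph. -/
theorem stmt12 (d : ℕ) (hd : 1 ≤ d) (z : ℕ) (hz : 1 ≤ z)
    (p : ℕ → EuclideanSpace ℝ (Fin d))
    (m : ℕ) (hm1 : 1 ≤ m) (hmz : m ≤ z)
    (ρ : ℕ → ℝ)
    (h1 : ∀ i, 1 ≤ i → i < m → ρ i = ‖p i - p (i + 1)‖)
    (h2 : ∀ i, m < i → i ≤ z → ρ i = ‖p i - p (i - 1)‖)
    (h3 : ρ m = max ‖p m - p 1‖ ‖p m - p z‖) :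
    ∀ a b : ℕ, 1 ≤ a → a ≤ z → 1 ≤ b → b ≤ z →
      Relation.ReflTransGen
        (fun a b : ℕ => 1 ≤ a ∧ a ≤ z ∧ 1 ≤ b ∧ b ≤ z ∧ a ≠ b ∧ ‖p a - p b‖ ≤ ρ a)
        a b := by
  set R : ℕ → ℕ → Prop :=
    fun a b : ℕ => 1 ≤ a ∧ a ≤ z ∧ 1 ≤ b ∧ b ≤ z ∧ a ≠ b ∧ ‖p a - p b‖ ≤ ρ a
  have up : ∀ i j, 1 ≤ i → i ≤ j → j ≤ m → Relation.ReflTransGen R i j := by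
    intro i j hi hij
    induction j, hij using Nat.le_induction with
    | base => exact fun _ => .refl
    | succ j hij ih =>
      intro hj
      refine (ih (by lia)).tail ⟨by lia, by lia, by lia, by lia, by lia, ?_⟩
      exact (h1 j (by lia) (by lia)).ge
  have down : ∀ i j, m ≤ i → i ≤ j → j ≤ z → Relation.ReflTransGen R j i := by
    intro i j hi hij
    induction j, hij using Nat.le_induction with
    | base => exact fun _ => .refl
    | succ j hij ih =>
      intro hj
      refine .head ⟨by lia, by lia, by lia, by lia, by lia, ?_⟩ (ih (by lia))
      exact (h2 (j + 1) (by lia) hj).ge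
  have hub_first : Relation.ReflTransGen R m 1 := by
    rcases eq_or_ne m 1 with h | h
    · rw [h]
    · exact .single ⟨hm1, hmz, le_rfl, hz, h, h3 ▸ le_max_left _ _⟩
  have hub_last : Relation.ReflTransGen R m z := by
    rcases eq_or_ne m z with h | h
    · rw [h]
    · exact .single ⟨hm1, hmz, hz, le_rfl, h, h3 ▸ le_max_right _ _⟩
  intro a b ha haz hb hbz
  have to_hub : Relation.ReflTransGen R a m :=
    (le_total a m).elim (fun h => up a m ha h le_rfl) (fun h => down m a le_rfl h haz)
  have from_hub : Relation.ReflTransGen R m b :=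
    (le_total b m).elim (fun h => hub_first.trans (up 1 b le_rfl hb h))
      (fun h => hub_last.trans (down b z h hbz le_rfl))
  exact to_hub.trans from_hub
end
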